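/- For n ≥ 1 let E_n denote the number of 0-1-2 increasing trees with vertex set {0,1,…,n-1} (the Euler number), and set E_0 = 1. Then in the formal power series ring ℚ[[t]], (Σ_{n≥0} E_n tⁿ/n!) · (Σ_{m≥0} (-1)^m t^{2m}/(2m)!) = 1 + Σ_{m≥0} (-1)^m t^{2m+1}/(2m+1)!; that is, Σ_{n≥0} E_n tⁿ/n! = sec t + tan t. -/

import Mathlib

/-- `deg p v` is the number of children of vertex `v` in the increasing tree on
`{0,1,…,n}` encoded by the parent function `p` (vertex `i+1` has parent `p i`). -/
def deg {n : ℕ} (p : Fin n → Fin (n + 1)) (v : Fin (n + 1)) : ℕ :=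
  (Finset.univ.filter fun i => p i = v).card

/-- `eulerNum n` is the number of `0-1-2` increasing trees with vertex set
`{0,1,…,n-1}` for `n ≥ 1`, and `eulerNum 0 = 1`. -/
noncomputable def eulerNum : ℕ → ℕ
  | 0 => 1
  | (n + 1) => Nat.card {p : Fin n → Fin (n + 1) //
      (∀ i : Fin n, (p i : ℕ) ≤ (i : ℕ)) ∧ ∀ v : Fin (n + 1), deg p v ≤ 2}


open PowerSeries in
theorem d_sin : derivative ℚ (sin ℚ) = cos ℚ := by
  ext n
  rw [coeff_derivative]
  simp only [sin, cos, coeff_mk, Nat.even_add_one]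
  by_cases h : Even n
  · obtain ⟨m, rfl⟩ := h
    have h1 : (m + m + 1) / 2 = m := by omega
    have h2 : (m + m) / 2 = m := by omega
    have : ((m + m : ℕ) : ℚ) + 1 ≠ 0 := by positivity
    simp only [h1, h2, Nat.factorial_succ]
    simp
    field_simp
  · simp [h]

open PowerSeries in
theorem d_cos : derivative ℚ (cos ℚ) = - sin ℚ := by
  ext n
  rw [coeff_derivative]
  simp only [sin, cos, coeff_mk, Nat.even_add_one, map_neg]
  by_cases h : Even n
  · simp [h]
  · obtain ⟨m, rfl⟩ := Nat.not_even_iff_odd.mp h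
    have h1 : (2 * m + 1 + 1) / 2 = m + 1 := by omega
    have h2 : (2 * m + 1) / 2 = m := by omega
    have : ((2 * m + 1 : ℕ) : ℚ) + 1 ≠ 0 := by positivity
    simp only [h1, h2, Nat.factorial_succ (2 * m + 1)]
    simp only [h, not_false_eq_true, if_true, if_false]
    simp only [Algebra.algebraMap_self, RingHom.id_apply, Nat.cast_mul, Nat.cast_add_one (2 * m + 1)]
    have h3 : ((2 * m + 1).factorial : ℚ) ≠ 0 := by positivity
    field_simp
    ring

open PowerSeries in
theorem cc_sin : constantCoeff (sin ℚ) = 0 := by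
  rw [← coeff_zero_eq_constantCoeff_apply]; simp [sin]

open PowerSeries in
theorem cc_cos : constantCoeff (cos ℚ) = 1 := by
  rw [← coeff_zero_eq_constantCoeff_apply]; simp [cos]

open PowerSeries in
theorem sq_sum : sin ℚ * sin ℚ + cos ℚ * cos ℚ = 1 := by
  apply derivative.ext
  · simp only [map_add, Derivation.leibniz, d_sin, d_cos, smul_eq_mul, derivative_one]
    ring
  · simp [cc_sin, cc_cos]

noncomputable def uX : PowerSeries ℚ := (1 - PowerSeries.sin ℚ)⁻¹
noncomputable def uY : PowerSeries ℚ := PowerSeries.cos ℚ * uX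

open PowerSeries in
theorem uX_mul : (1 - sin ℚ) * uX = 1 := by
  apply PowerSeries.mul_inv_cancel
  simp [cc_sin]

open PowerSeries in
theorem d_uX : derivative ℚ uX = uX * uY := by
  unfold uY
  conv_lhs => rw [uX, derivative_inv']
  simp only [map_sub, derivative_one, d_sin]
  rw [← uX]; ring

open PowerSeries in
theorem d_uY : derivative ℚ uY = uX := by
  rw [uY, Derivation.leibniz, d_uX, d_cos, uY]
  simp only [smul_eq_mul]
  linear_combination (uX ^ 2) * sq_sum + (uX + sin ℚ * uX) * uX_mul

open PowerSeries in
theorem uY_mul : uY * cos ℚ = 1 + sin ℚ := by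
  rw [uY]
  linear_combination uX * sq_sum + (1 + sin ℚ) * uX_mul

open PowerSeries in
theorem cc_uX : constantCoeff uX = 1 := by
  have := congrArg constantCoeff uX_mul
  simpa [cc_sin] using this

open PowerSeries in
theorem cc_uY : constantCoeff uY = 1 := by
  simp [uY, cc_uX, cc_cos]

noncomputable def wt : ℕ → PowerSeries ℚ
  | 0 => uX
  | 1 => uY
  | 2 => 1
  | _ => 0

open PowerSeries in
theorem d_wt (k : ℕ) : derivative ℚ (wt k) = uX * wt (k + 1) := by
  match k with
  | 0 => exact d_uX
  | 1 => simp [wt, d_uY]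
  | 2 => simp [wt, derivative_one]
  | (k + 3) => simp [wt]

open PowerSeries in
theorem cc_wt (k : ℕ) : constantCoeff (wt k) = if k ≤ 2 then 1 else 0 := by
  match k with
  | 0 => simp [wt, cc_uX]
  | 1 => simp [wt, cc_uY]
  | 2 => simp [wt]
  | (k + 3) => simp [wt]

open PowerSeries in
theorem d_prod (k : ℕ → ℕ) (s : Finset ℕ) :
    derivative ℚ (∏ u ∈ s, wt (k u)) =
      ∑ v ∈ s, uX * ∏ u ∈ s, wt (k u + if v = u then 1 else 0) := by
  induction s using Finset.induction_on with
  | empty => simp [derivative_one]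
  | insert a s ha ih =>
    rw [Finset.prod_insert ha, Derivation.leibniz, ih, d_wt, Finset.sum_insert ha,
      Finset.prod_insert ha]
    have h1 : ∏ u ∈ s, wt (k u + if a = u then 1 else 0) = ∏ u ∈ s, wt (k u) := by
      refine Finset.prod_congr rfl fun u hu => ?_
      have : a ≠ u := by rintro rfl; exact ha hu
      simp [this]
    have h2 : ∑ v ∈ s, uX * ∏ u ∈ insert a s, wt (k u + if v = u then 1 else 0)
        = wt (k a) * ∑ v ∈ s, uX * ∏ u ∈ s, wt (k u + if v = u then 1 else 0) := by
      rw [Finset.mul_sum]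
      refine Finset.sum_congr rfl fun v hv => ?_
      have : v ≠ a := by rintro rfl; exact ha hv
      rw [Finset.prod_insert ha]
      simp only [this, if_false, add_zero]
      ring
    rw [h1, h2]
    simp only [smul_eq_mul, if_true]
    ring

abbrev PF (n : ℕ) : Type := (i : Fin n) → Fin (i.val + 1)

def dg {n : ℕ} (f : PF n) (v : ℕ) : ℕ := ∑ i : Fin n, if (f i).val = v then 1 else 0

noncomputable def WT (n : ℕ) : PowerSeries ℚ :=
  ∑ f : PF n, ∏ v ∈ Finset.range (n + 1), wt (dg f v)

def snocPF (n : ℕ) : Fin (n + 1) × PF n ≃ PF (n + 1) :=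
  Fin.snocEquiv (fun i : Fin (n + 1) => Fin (i.val + 1))

theorem dg_snoc {n : ℕ} (x : Fin (n + 1)) (f : PF n) (u : ℕ) :
    dg (snocPF n (x, f)) u = dg f u + if x.val = u then 1 else 0 := by
  unfold dg
  rw [Fin.sum_univ_castSucc]
  simp [snocPF, Fin.snocEquiv]

theorem dg_big {n : ℕ} (f : PF n) (u : ℕ) (h : n ≤ u) : dg f u = 0 := by
  unfold dg
  refine Finset.sum_eq_zero fun i _ => ?_
  have := (f i).isLt
  have := i.isLt
  rw [if_neg]; omega

open PowerSeries in
theorem d_WT (n : ℕ) : derivative ℚ (WT n) = WT (n + 1) := by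
  unfold WT
  rw [map_sum, ← (snocPF n).sum_comp, Fintype.sum_prod_type_right]
  refine Finset.sum_congr rfl fun f _ => ?_
  rw [d_prod, ← Fin.sum_univ_eq_sum_range
    (fun v => uX * ∏ u ∈ Finset.range (n + 1), wt (dg f u + if v = u then 1 else 0))]
  refine Finset.sum_congr rfl fun x _ => ?_
  rw [Finset.prod_range_succ _ (n + 1)]
  simp only [dg_snoc]
  have hx : x.val ≠ n + 1 := by have := x.isLt; omega
  rw [dg_big f (n + 1) (by omega), if_neg hx, mul_comm]
  rfl

open PowerSeries in
theorem iter_d (n : ℕ) : (derivative ℚ)^[n + 1] uY = WT n := by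
  induction n with
  | zero => simp [WT, d_uY, dg, wt]
  | succ n ih => rw [Function.iterate_succ_apply', ih, d_WT]

open PowerSeries Classical in
theorem cc_WT (n : ℕ) : constantCoeff (WT n) =
    (Nat.card {f : PF n // ∀ v ∈ Finset.range (n + 1), dg f v ≤ 2} : ℚ) := by
  rw [Nat.card_eq_fintype_card, Fintype.card_subtype, WT, map_sum, Finset.card_filter]
  push_cast
  refine Finset.sum_congr rfl fun f _ => ?_
  rw [map_prod]
  simp only [cc_wt]
  rw [Finset.prod_ite_zero]
  simp

def treeEquiv (n : ℕ) : {p : Fin n → Fin (n + 1) //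
      (∀ i : Fin n, (p i : ℕ) ≤ (i : ℕ)) ∧ ∀ v : Fin (n + 1), deg p v ≤ 2} ≃
    {f : PF n // ∀ v ∈ Finset.range (n + 1), dg f v ≤ 2} where
  toFun p := ⟨fun i => ⟨(p.1 i).val, Nat.lt_succ_of_le (p.2.1 i)⟩, by
    intro v hv
    have := p.2.2 ⟨v, Finset.mem_range.mp hv⟩
    rw [deg, Finset.card_filter] at this
    simpa [dg, Fin.ext_iff] using this⟩
  invFun f := ⟨fun i => ⟨(f.1 i).val, by have := (f.1 i).isLt; omega⟩, by
    refine ⟨fun i => Nat.le_of_lt_succ (f.1 i).isLt, fun v => ?_⟩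
    have := f.2 v.val (Finset.mem_range.mpr v.isLt)
    rw [deg, Finset.card_filter]
    simpa [dg, Fin.ext_iff] using this⟩
  left_inv p := rfl
  right_inv f := rfl

open PowerSeries in
theorem euler_coeff (n : ℕ) : (eulerNum n : ℚ) / (n.factorial : ℚ) = coeff n uY := by
  have h := constantCoeff_iterate_derivative uY n
  rw [div_eq_iff (by positivity), mul_comm, ← h]
  cases n with
  | zero => simp [eulerNum, cc_uY]
  | succ n =>
    rw [iter_d, cc_WT, eulerNum, Nat.card_congr (treeEquiv n)]

/-- `∑_{n≥0} E_n tⁿ/n! = sec t + tan t`, written with the denominator cleared: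
`(∑ E_n tⁿ/n!) · cos t = 1 + sin t`. -/
theorem stmt10 :
    (PowerSeries.mk fun n => (eulerNum n : ℚ) / (n.factorial : ℚ)) *
        (PowerSeries.mk fun j =>
          if Even j then (-1 : ℚ) ^ (j / 2) / (j.factorial : ℚ) else 0) =
      1 + PowerSeries.mk fun j =>
          if Even j then 0 else (-1 : ℚ) ^ (j / 2) / (j.factorial : ℚ) := by
  have h1 : (PowerSeries.mk fun n => (eulerNum n : ℚ) / (n.factorial : ℚ)) = uY := by
    ext n; rw [PowerSeries.coeff_mk, euler_coeff]
  have h := uY_mul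
  rw [h1]
  simpa [PowerSeries.sin, PowerSeries.cos] using h
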